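/- Assume the LDBSM conditions (a)–(f) hold. Then there exists a single automaton-controller π^A such that for every x₀ ∈ Init, both of the following hold for the product trajectory (x_t, q_t) from (x₀, q_init) under π^A: (1) d^∞({ω : ℕ → W | for all t ∈ ℕ, V^safe(x_t, q_t) < 0}) ≥ 1 − exp(8·η^S·ε^S/(M^S)²), and (2) d^∞({ω : ℕ → W | (q_t ∈ Acc for infinitely many t) or (there exists t with V^safe(x_t, q_t) ≥ 0)}) = 1. -/

import Mathlib

open MeasureTheory

/-- The trajectory of the closed-loop dynamics `F` from initial state `x₀`
under the disturbance sequence `ω`. -/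
def traj {X W : Type*} (F : X × W → X) (x₀ : X) (ω : ℕ → W) : ℕ → X
  | 0 => x₀
  | t + 1 => F (traj F x₀ ω t, ω t)

/-- Büchi acceptance of an infinite word `σ` by the automaton
`(Q, qinit, Δ, Acc)`. -/
def Accepts {Q A : Type*} (qinit : Q) (Δ : Q → A → Set Q) (Acc : Set Q)
    (σ : ℕ → A) : Prop :=
  ∃ ρ : ℕ → Q, ρ 0 = qinit ∧ (∀ t, ρ (t + 1) ∈ Δ (ρ t) (σ t)) ∧
    {t | ρ t ∈ Acc}.Infinite

/-- The product trajectory `(x_t, q_t)` from `(x₀, qinit)` under the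
automaton-controller `πA` and disturbance sequence `ω`. -/
def prodTraj {X W Q : Type*} (F : X × W → X) (πA : X × Q → Q)
    (x₀ : X) (qinit : Q) (ω : ℕ → W) : ℕ → X × Q
  | 0 => (x₀, qinit)
  | t + 1 =>
      (F ((prodTraj F πA x₀ qinit ω t).1, ω t), πA (prodTraj F πA x₀ qinit ω t))

/-- The set of rejecting states: automaton states from which no accepting
state is reachable in the graph induced by the transitions. -/
def Qreject {Q A : Type*} (Δ : Q → A → Set Q) (Acc : Set Q) : Set Q :=
  {q | ∀ q', Relation.ReflTransGen (fun a b => ∃ σ : A, b ∈ Δ a σ) q q' → q' ∉ Acc}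

/-- The safety condition `SafetyCond(x, q, σ, q')`: the letter `σ` holds at
`x`; the successor stays in the invariant `I` for every disturbance; the
expected value of `Vsafe` strictly decreases by at least `εS`; and the change
of `Vsafe` lies in the interval `[βS, βS + MS]` for every disturbance. -/
def SafetyCond {X W Q A : Type*} [MeasurableSpace W]
    (d : Measure W) (F : X × W → X) (L : X → A) (I : Set (X × Q))
    (Vsafe : X × Q → ℝ) (εS MS βS : ℝ) (x : X) (q : Q) (σ : A) (q' : Q) :
    Prop :=
  L x = σ ∧ (∀ w, (F (x, w), q') ∈ I) ∧
    (∫ w, Vsafe (F (x, w), q') ∂d) ≤ Vsafe (x, q) - εS ∧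
    ∀ w, βS ≤ Vsafe (x, q) - Vsafe (F (x, w), q') ∧
      Vsafe (x, q) - Vsafe (F (x, w), q') ≤ βS + MS

/-- Prepend a disturbance to a disturbance sequence. -/
def consSeq {W : Type*} (p : W × (ℕ → W)) : ℕ → W
  | 0 => p.1
  | n + 1 => p.2 n

theorem measurable_consSeq {W : Type*} [MeasurableSpace W] :
    Measurable (consSeq : W × (ℕ → W) → ℕ → W) := by
  rw [measurable_pi_iff]
  intro n
  cases n with
  | zero => exact measurable_fst
  | succ n => exact (measurable_pi_apply n).comp measurable_snd

theorem eq_infinitePi_of_cyl {W : Type*} [MeasurableSpace W]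
    (d : Measure W) [IsProbabilityMeasure d]
    (ν : Measure (ℕ → W))
    (h : ∀ (n : ℕ) (s : ℕ → Set W), (∀ i, MeasurableSet (s i)) →
      ν {ω | ∀ i < n, ω i ∈ s i} = ∏ i ∈ Finset.range n, d (s i)) :
    ν = Measure.infinitePi (fun _ : ℕ => d) := by
  classical
  apply Measure.eq_infinitePi
  intro s t ht
  obtain ⟨n, hn⟩ := s.exists_nat_subset_range
  have := h n (fun i => if i ∈ s then t i else Set.univ) (by
    intro i; split_ifs
    · exact ht i
    · exact MeasurableSet.univ)
  have e : {ω : ℕ → W | ∀ i < n, ω i ∈ (if i ∈ s then t i else Set.univ)} = Set.pi s t := by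
    ext ω
    simp only [Set.mem_ofPred_eq, Set.mem_pi, Finset.mem_coe]
    constructor
    · intro H i hi
      have := H i (Finset.mem_range.1 (hn hi))
      simpa [hi] using this
    · intro H i _
      split_ifs with hi
      · exact H i hi
      · trivial
  rw [e] at this
  rw [this, ← Finset.prod_subset hn]
  · exact Finset.prod_congr rfl (fun i hi => by simp [hi])
  · intro i _ hi
    simp [hi]

theorem map_consSeq {W : Type*} [MeasurableSpace W]
    (d : Measure W) [IsProbabilityMeasure d]
    (dInf : Measure (ℕ → W)) [IsProbabilityMeasure dInf]
    (h : ∀ (n : ℕ) (s : ℕ → Set W), (∀ i, MeasurableSet (s i)) →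
      dInf {ω | ∀ i < n, ω i ∈ s i} = ∏ i ∈ Finset.range n, d (s i)) :
    (d.prod dInf).map consSeq = dInf := by
  rw [eq_infinitePi_of_cyl d dInf h]
  apply eq_infinitePi_of_cyl
  rw [← eq_infinitePi_of_cyl d dInf h]
  intro n s hs
  have hm : MeasurableSet {ω : ℕ → W | ∀ i < n, ω i ∈ s i} := by
    have : {ω : ℕ → W | ∀ i < n, ω i ∈ s i} = ⋂ i, ⋂ (_ : i < n), (fun ω => ω i) ⁻¹' s i := by
      ext; simp
    rw [this]
    exact MeasurableSet.iInter fun i => MeasurableSet.iInter fun _ => measurable_pi_apply i (hs i)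
  rw [Measure.map_apply measurable_consSeq hm]
  cases n with
  | zero => simp
  | succ n =>
    have : consSeq ⁻¹' {ω : ℕ → W | ∀ i < n + 1, ω i ∈ s i}
        = s 0 ×ˢ {ω : ℕ → W | ∀ i < n, ω i ∈ s (i + 1)} := by
      ext ⟨w, ω⟩
      simp only [Set.mem_preimage, Set.mem_ofPred_eq, Set.mem_prod]
      constructor
      · intro H
        exact ⟨H 0 (by omega), fun i hi => H (i + 1) (by omega)⟩
      · rintro ⟨h0, h1⟩ i hi
        cases i with
        | zero => exact h0
        | succ i => exact h1 i (by omega)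
    rw [this, Measure.prod_prod, h n (fun i => s (i + 1)) (fun i => hs _),
      Finset.prod_range_succ', mul_comm]

theorem measure_consSeq {W : Type*} [MeasurableSpace W]
    (d : Measure W) [IsProbabilityMeasure d]
    (dInf : Measure (ℕ → W)) [IsProbabilityMeasure dInf]
    (h : (d.prod dInf).map consSeq = dInf) {S : Set (ℕ → W)} (hS : MeasurableSet S) :
    dInf S = ∫⁻ w, dInf {ω | consSeq (w, ω) ∈ S} ∂d := by
  conv_lhs => rw [← h]
  rw [Measure.map_apply measurable_consSeq hS, Measure.prod_apply (measurable_consSeq hS)]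
  rfl

theorem prodTraj_cons {X W Q : Type*} (F : X × W → X) (πA : X × Q → Q) (x : X) (q : Q)
    (w : W) (ω : ℕ → W) (t : ℕ) :
    prodTraj F πA x q (consSeq (w, ω)) (t + 1)
      = prodTraj F πA (F (x, w)) (πA (x, q)) ω t := by
  induction t with
  | zero => rfl
  | succ t ih =>
    rw [prodTraj, ih]
    rfl

theorem measurable_prodTraj {X W Q : Type*} [MeasurableSpace X] [MeasurableSpace W]
    [MeasurableSpace Q] (F : X × W → X) (hF : Measurable F) (πA : X × Q → Q)
    (hπ : Measurable πA) (x : X) (q : Q) (t : ℕ) :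
    Measurable (fun ω : ℕ → W => prodTraj F πA x q ω t) := by
  induction t with
  | zero => exact measurable_const
  | succ t ih =>
    exact (hF.comp ((measurable_fst.comp ih).prodMk (measurable_pi_apply t))).prodMk (hπ.comp ih)

/-- Hoeffding step: the exponential of the safety certificate is a supermartingale. -/
theorem hoeffding_step {W : Type*} [MeasurableSpace W]
    (d : Measure W) [IsProbabilityMeasure d] (Y : W → ℝ) (hY : Measurable Y)
    (v ε M β : ℝ) (hε : 0 < ε) (hM : 0 < M)
    (hmean : ∫ w, Y w ∂d ≤ v - ε)
    (hb : ∀ᵐ w ∂d, β ≤ v - Y w ∧ v - Y w ≤ β + M) :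
    ∫⁻ w, ENNReal.ofReal (Real.exp (8 * ε / M ^ 2 * Y w)) ∂d
      ≤ ENNReal.ofReal (Real.exp (8 * ε / M ^ 2 * v)) := by
  have hb' : ∀ᵐ w ∂d, Y w ∈ Set.Icc (v - β - M) (v - β) := by
    filter_upwards [hb] with w hw
    constructor <;> linarith [hw.1, hw.2]
  have hs := ProbabilityTheory.hasSubgaussianMGF_of_mem_Icc hY.aemeasurable hb'
  set l := 8 * ε / M ^ 2 with hl
  have hlpos : 0 < l := by positivity
  have h1 := hs.mgf_le l
  have hi := hs.integrable_exp_mul l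
  set m := ∫ w, Y w ∂d with hm
  have e : (fun w => Real.exp (l * Y w)) = fun w => Real.exp (l * m) * Real.exp (l * (Y w - m)) := by
    funext w; rw [← Real.exp_add]; congr 1; ring
  have hint : Integrable (fun w => Real.exp (l * Y w)) d := by
    rw [e]; exact hi.const_mul _
  rw [← ofReal_integral_eq_lintegral_ofReal hint (Filter.Eventually.of_forall fun w => (Real.exp_pos _).le)]
  apply ENNReal.ofReal_le_ofReal
  rw [e, integral_const_mul]
  unfold ProbabilityTheory.mgf at h1
  refine (mul_le_mul_of_nonneg_left h1 (Real.exp_pos _).le).trans ?_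
  rw [← Real.exp_add]
  apply Real.exp_le_exp.2
  have hn : ((‖(v - β) - (v - β - M)‖₊ : NNReal) : ℝ) = M := by
    rw [coe_nnnorm, Real.norm_eq_abs]
    rw [show (v - β) - (v - β - M) = M by ring, abs_of_pos hM]
  push_cast
  simp only [coe_nnnorm] at hn ⊢
  rw [hn]
  have hlM : l * M ^ 2 = 8 * ε := by rw [hl]; field_simp
  have : (M / 2) ^ 2 * l ^ 2 / 2 = l * ε := by
    have : (M / 2) ^ 2 * l ^ 2 / 2 = l * (l * M ^ 2) / 8 := by ring
    rw [this, hlM]; ring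
  rw [this]
  nlinarith

theorem safety_bound {X W Q : Type*} [MeasurableSpace X] [MeasurableSpace W]
    [MeasurableSpace Q]
    (d : Measure W) [IsProbabilityMeasure d]
    (dInf : Measure (ℕ → W)) [IsProbabilityMeasure dInf]
    (h : (d.prod dInf).map consSeq = dInf)
    (F : X × W → X) (hF : Measurable F) (πA : X × Q → Q) (hπ : Measurable πA)
    (I : Set (X × Q)) (V : X × Q → ℝ) (hV : Measurable V)
    (ε M β : ℝ) (hε : 0 < ε) (hM : 0 < M)
    (hI : ∀ x q, (x, q) ∈ I → V (x, q) < 0 → ∀ᵐ w ∂d, (F (x, w), πA (x, q)) ∈ I)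
    (hmean : ∀ x q, (x, q) ∈ I → V (x, q) < 0 →
      ∫ w, V (F (x, w), πA (x, q)) ∂d ≤ V (x, q) - ε)
    (hb : ∀ x q, (x, q) ∈ I → V (x, q) < 0 → ∀ᵐ w ∂d,
      β ≤ V (x, q) - V (F (x, w), πA (x, q)) ∧
      V (x, q) - V (F (x, w), πA (x, q)) ≤ β + M)
    (n : ℕ) : ∀ x q, (x, q) ∈ I →
      dInf {ω | ∃ t ≤ n, 0 ≤ V (prodTraj F πA x q ω t)}
        ≤ ENNReal.ofReal (Real.exp (8 * ε / M ^ 2 * V (x, q))) := by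
  have hlpos : 0 < 8 * ε / M ^ 2 := by positivity
  have triv : ∀ x q, 0 ≤ V (x, q) → ∀ S : Set (ℕ → W),
      dInf S ≤ ENNReal.ofReal (Real.exp (8 * ε / M ^ 2 * V (x, q))) := by
    intro x q hq S
    refine prob_le_one.trans ?_
    rw [ENNReal.one_le_ofReal]
    exact Real.one_le_exp (by positivity)
  induction n with
  | zero =>
    intro x q hxq
    by_cases hv : 0 ≤ V (x, q)
    · exact triv x q hv _
    · have : {ω : ℕ → W | ∃ t ≤ 0, 0 ≤ V (prodTraj F πA x q ω t)} = ∅ := by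
        ext ω
        simp only [Set.mem_ofPred_eq, Set.mem_empty_iff_false, iff_false]
        rintro ⟨t, ht, h0⟩
        obtain rfl : t = 0 := by omega
        exact hv h0
      rw [this]; simp
  | succ n ih =>
    intro x q hxq
    by_cases hv : 0 ≤ V (x, q)
    · exact triv x q hv _
    have hv' := not_le.1 hv
    have hS : MeasurableSet {ω : ℕ → W | ∃ t ≤ n + 1, 0 ≤ V (prodTraj F πA x q ω t)} := by
      have : {ω : ℕ → W | ∃ t ≤ n + 1, 0 ≤ V (prodTraj F πA x q ω t)}
          = ⋃ t, ⋃ (_ : t ≤ n + 1), {ω | 0 ≤ V (prodTraj F πA x q ω t)} := by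
        ext; simp
      rw [this]
      exact MeasurableSet.iUnion fun t => MeasurableSet.iUnion fun _ =>
        measurableSet_le measurable_const (hV.comp (measurable_prodTraj F hF πA hπ x q t))
    rw [measure_consSeq d dInf h hS]
    refine le_trans (lintegral_mono_ae ?_) (hoeffding_step d (fun w => V (F (x, w), πA (x, q)))
      (hV.comp ((hF.comp measurable_prodMk_left).prodMk measurable_const)) (V (x, q)) ε M β hε hM
      (hmean x q hxq hv') (hb x q hxq hv'))
    filter_upwards [hI x q hxq hv'] with w hw
    refine le_trans (measure_mono ?_) (ih _ _ hw)
    rintro ω ⟨t, ht, h0⟩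
    cases t with
    | zero => exact absurd h0 hv
    | succ t =>
      rw [prodTraj_cons] at h0
      exact ⟨t, by omega, h0⟩

theorem live_zero {X W Q : Type*} [MeasurableSpace X] [MeasurableSpace W]
    [MeasurableSpace Q] [DiscreteMeasurableSpace Q]
    (d : Measure W) [IsProbabilityMeasure d]
    (dInf : Measure (ℕ → W)) [IsProbabilityMeasure dInf]
    (h : (d.prod dInf).map consSeq = dInf)
    (F : X × W → X) (hF : Measurable F) (πA : X × Q → Q) (hπ : Measurable πA)
    (I : Set (X × Q)) (V U : X × Q → ℝ) (hV : Measurable V) (Acc : Set Q)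
    (hInt : ∀ (x : X) (q' : Q), Integrable (fun w => U (F (x, w), q')) d)
    (ε : ℝ) (hε : 0 < ε)
    (hU : ∀ x q, (x, q) ∈ I → 0 ≤ U (x, q))
    (hI : ∀ x q, (x, q) ∈ I → V (x, q) < 0 → ∀ᵐ w ∂d, (F (x, w), πA (x, q)) ∈ I)
    (hdec : ∀ x q, (x, q) ∈ I → V (x, q) < 0 → q ∉ Acc →
      ∫ w, U (F (x, w), πA (x, q)) ∂d ≤ U (x, q) - ε)
    (T : ℕ) : ∀ x q, (x, q) ∈ I →
      dInf {ω | ∀ t, V (prodTraj F πA x q ω t) < 0 ∧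
        (T ≤ t → (prodTraj F πA x q ω t).2 ∉ Acc)} = 0 := by
  have hS : ∀ T x q, MeasurableSet {ω | ∀ t, V (prodTraj F πA x q ω t) < 0 ∧
        (T ≤ t → (prodTraj F πA x q ω t).2 ∉ Acc)} := by
    intro T x q
    have : {ω | ∀ t, V (prodTraj F πA x q ω t) < 0 ∧
        (T ≤ t → (prodTraj F πA x q ω t).2 ∉ Acc)} =
        ⋂ t, ({ω | V (prodTraj F πA x q ω t) < 0} ∩
          ⋂ (_ : T ≤ t), (fun ω => (prodTraj F πA x q ω t).2) ⁻¹' Accᶜ) := by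
      ext; simp
    rw [this]
    have hm := measurable_prodTraj F hF πA hπ x q
    exact MeasurableSet.iInter fun t =>
      (measurableSet_lt (hV.comp (hm t)) measurable_const).inter
        (MeasurableSet.iInter fun _ => (measurable_snd.comp (hm t)) (MeasurableSet.of_discrete))
  induction T with
  | zero =>
    have key : ∀ N : ℕ, ∀ x q, (x, q) ∈ I → (N : ENNReal) * ENNReal.ofReal ε *
        dInf {ω | ∀ t, V (prodTraj F πA x q ω t) < 0 ∧
        (0 ≤ t → (prodTraj F πA x q ω t).2 ∉ Acc)} ≤ ENNReal.ofReal (U (x, q)) := by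
      intro N
      induction N with
      | zero => intro x q _; simp
      | succ N ih =>
        intro x q hxq
        by_cases hg : V (x, q) < 0 ∧ q ∉ Acc
        · have h1 : (N : ENNReal) * ENNReal.ofReal ε *
            dInf {ω | ∀ t, V (prodTraj F πA x q ω t) < 0 ∧
            (0 ≤ t → (prodTraj F πA x q ω t).2 ∉ Acc)} ≤
              ENNReal.ofReal (U (x, q) - ε) := by
            rw [measure_consSeq d dInf h (hS 0 x q), ← lintegral_const_mul' _ _
              (ENNReal.mul_ne_top (ENNReal.natCast_ne_top N) ENNReal.ofReal_ne_top)]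
            refine le_trans ?_ (ENNReal.ofReal_le_ofReal (hdec x q hxq hg.1 hg.2))
            rw [ofReal_integral_eq_lintegral_ofReal (hInt _ _)
              ((hI x q hxq hg.1).mono fun w hw => hU _ _ hw)]
            refine lintegral_mono_ae ?_
            filter_upwards [hI x q hxq hg.1] with w hw
            refine le_trans (mul_le_mul_right (measure_mono ?_) _) (ih _ _ hw)
            intro ω H t
            have := H (t + 1)
            rw [prodTraj_cons] at this
            exact ⟨this.1, fun _ => this.2 (by omega)⟩
          have hpos : 0 ≤ U (x, q) - ε := by
            refine le_trans ?_ (hdec x q hxq hg.1 hg.2)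
            exact integral_nonneg_of_ae ((hI x q hxq hg.1).mono fun w hw => hU _ _ hw)
          push_cast
          rw [add_mul, one_mul, add_mul]
          calc _ ≤ ENNReal.ofReal (U (x, q) - ε) + ENNReal.ofReal ε * 1 :=
                add_le_add h1 (mul_le_mul_right prob_le_one _)
            _ = _ := by
                rw [mul_one, ← ENNReal.ofReal_add hpos hε.le, sub_add_cancel]
        · have : {ω | ∀ t, V (prodTraj F πA x q ω t) < 0 ∧
            (0 ≤ t → (prodTraj F πA x q ω t).2 ∉ Acc)} = ∅ := by
            ext ω
            simp only [Set.mem_ofPred_eq, Set.mem_empty_iff_false, iff_false]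
            intro H
            exact hg ⟨(H 0).1, (H 0).2 le_rfl⟩
          rw [this]; simp
    intro x q hxq
    by_contra hne
    set p := dInf {ω | ∀ t, V (prodTraj F πA x q ω t) < 0 ∧
        (0 ≤ t → (prodTraj F πA x q ω t).2 ∉ Acc)} with hp
    have hne' : ENNReal.ofReal ε * p ≠ 0 := mul_ne_zero (by simpa using hε) hne
    obtain ⟨N, hN⟩ := ENNReal.exists_nat_mul_gt hne' (ENNReal.ofReal_ne_top (r := U (x, q)))
    have := key N x q hxq
    rw [mul_assoc] at this
    exact absurd hN (not_lt.2 this)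
  | succ T ih =>
    intro x q hxq
    by_cases hv : V (x, q) < 0
    · rw [measure_consSeq d dInf h (hS _ x q)]
      apply lintegral_eq_zero_of_ae_eq_zero
      filter_upwards [hI x q hxq hv] with w hw
      refine measure_mono_null ?_ (ih _ _ hw)
      intro ω H t
      have := H (t + 1)
      rw [prodTraj_cons] at this
      exact ⟨this.1, fun _ => this.2 (by omega)⟩
    · have : {ω | ∀ t, V (prodTraj F πA x q ω t) < 0 ∧
            (T + 1 ≤ t → (prodTraj F πA x q ω t).2 ∉ Acc)} = ∅ := by
        ext ω
        simp only [Set.mem_ofPred_eq, Set.mem_empty_iff_false, iff_false]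
        intro H
        exact hv (H 0).1
      rw [this]; simp

/-- Measurable selection from finitely many measurable options. -/
theorem exists_selector {X Q A : Type*} [MeasurableSpace X]
    [Fintype Q] [MeasurableSpace Q] [DiscreteMeasurableSpace Q]
    [Fintype A] [MeasurableSpace A] [DiscreteMeasurableSpace A]
    (Δ : Q → A → Set Q) (hΔ : ∀ q σ, (Δ q σ).Nonempty)
    (L : X → A) (hL : Measurable L) (C : Q → Set (X × Q)) (hC : ∀ q', MeasurableSet (C q')) :
    ∃ πA : X × Q → Q, Measurable πA ∧ (∀ x q, πA (x, q) ∈ Δ q (L x)) ∧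
      ∀ x q, (∃ q' ∈ Δ q (L x), (x, q) ∈ C q') → (x, q) ∈ C (πA (x, q)) := by
  classical
  have hex : ∀ p : (Q × A) × (Q → Prop), ∃ q', q' ∈ Δ p.1.1 p.1.2 ∧
      ((∃ q' ∈ Δ p.1.1 p.1.2, p.2 q') → p.2 q') := by
    intro p
    by_cases hp : ∃ q' ∈ Δ p.1.1 p.1.2, p.2 q'
    · obtain ⟨q', h1, h2⟩ := hp
      exact ⟨q', h1, fun _ => h2⟩
    · obtain ⟨q', h1⟩ := hΔ p.1.1 p.1.2
      exact ⟨q', h1, fun h => absurd h hp⟩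
  choose f hf1 hf2 using hex
  refine ⟨fun z => f ((z.2, L z.1), fun q' => z ∈ C q'), ?_, fun x q => hf1 ((q, L x), fun q' => (x, q) ∈ C q'),
    fun x q => hf2 ((q, L x), fun q' => (x, q) ∈ C q')⟩
  have hfm : Measurable f := measurable_of_finite f
  refine hfm.comp ((measurable_snd.prodMk (hL.comp measurable_fst)).prodMk ?_)
  rw [measurable_pi_iff]
  intro q'
  exact measurableSet_setOf.1 (hC q')

theorem ldbsm_safety_and_liveness
    {X W Q A : Type*}
    [MeasurableSpace X] [MeasurableSpace W]
    [Fintype Q] [MeasurableSpace Q] [DiscreteMeasurableSpace Q]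
    [Fintype A] [MeasurableSpace A] [DiscreteMeasurableSpace A]
    (d : Measure W) [IsProbabilityMeasure d]
    (dInf : Measure (ℕ → W)) [IsProbabilityMeasure dInf]
    (hdInf : ∀ (n : ℕ) (s : ℕ → Set W), (∀ i, MeasurableSet (s i)) →
      dInf {ω | ∀ i < n, ω i ∈ s i} = ∏ i ∈ Finset.range n, d (s i))
    (F : X × W → X) (hF : Measurable F)
    (qinit : Q) (Δ : Q → A → Set Q) (hΔ : ∀ q σ, (Δ q σ).Nonempty)
    (Acc : Set Q)
    (L : X → A) (hL : Measurable L)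
    (Init : Set X) (I : Set (X × Q)) (hI : MeasurableSet I)
    (Vsafe Vlive : X × Q → ℝ)
    (hVsafe : Measurable Vsafe) (hVlive : Measurable Vlive)
    (hIntSafe : ∀ (x : X) (q' : Q), Integrable (fun w => Vsafe (F (x, w), q')) d)
    (hIntLive : ∀ (x : X) (q' : Q), Integrable (fun w => Vlive (F (x, w), q')) d)
    (ηS εS MS βS εL ML : ℝ)
    (hηS : ηS ≤ 0) (hεS : 0 < εS) (hMS : 0 < MS) (hεL : 0 < εL) (hML : 0 < ML)
    -- (a) Initial condition of the invariant
    (ha : ∀ x ∈ Init, (x, qinit) ∈ I)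
    -- (b) Initial condition of the safety certificate
    (hb : ∀ x ∈ Init, Vsafe (x, qinit) ≤ ηS)
    -- (c) Safety condition of the safety certificate
    (hc : ∀ x q, (x, q) ∈ I → q ∈ Qreject Δ Acc → 0 ≤ Vsafe (x, q))
    -- (d) Non-negativity condition of the liveness certificate
    (hd : ∀ x q, (x, q) ∈ I → 0 ≤ Vlive (x, q))
    -- (e) Strict expected decrease of the liveness certificate
    (he : ∀ x q, (x, q) ∈ I → q ∉ Acc ∪ Qreject Δ Acc → Vsafe (x, q) ≤ 0 →
      ∃ σ q', q' ∈ Δ q σ ∧ SafetyCond d F L I Vsafe εS MS βS x q σ q' ∧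
        (∫ w, Vlive (F (x, w), q') ∂d) ≤ Vlive (x, q) - εL)
    -- (f) Bounded expected increase of the liveness certificate
    (hf : ∀ x q, (x, q) ∈ I → q ∈ Acc → Vsafe (x, q) ≤ 0 →
      ∃ σ q', q' ∈ Δ q σ ∧ SafetyCond d F L I Vsafe εS MS βS x q σ q' ∧
        (∫ w, Vlive (F (x, w), q') ∂d) ≤ Vlive (x, q) + ML) :
    ∃ πA : X × Q → Q, Measurable πA ∧ (∀ x q, πA (x, q) ∈ Δ q (L x)) ∧
      ∀ x₀ ∈ Init,
        ENNReal.ofReal (1 - Real.exp (8 * ηS * εS / MS ^ 2)) ≤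
            dInf {ω | ∀ t, Vsafe (prodTraj F πA x₀ qinit ω t) < 0} ∧
          dInf {ω | {t | (prodTraj F πA x₀ qinit ω t).2 ∈ Acc}.Infinite ∨
              ∃ t, 0 ≤ Vsafe (prodTraj F πA x₀ qinit ω t)} = 1 := by
  classical
  have hcons := map_consSeq d dInf hdInf
  let C : Q → Set (X × Q) := fun q' =>
    {z | (∀ᵐ w ∂d, (F (z.1, w), q') ∈ I) ∧
      (∫ w, Vsafe (F (z.1, w), q') ∂d) ≤ Vsafe z - εS ∧
      (∀ᵐ w ∂d, βS ≤ Vsafe z - Vsafe (F (z.1, w), q') ∧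
        Vsafe z - Vsafe (F (z.1, w), q') ≤ βS + MS) ∧
      (z.2 ∉ Acc → (∫ w, Vlive (F (z.1, w), q') ∂d) ≤ Vlive z - εL)}
  have hC : ∀ q', MeasurableSet (C q') := by
    intro q'
    have hg : Measurable (fun p : (X × Q) × W => (F (p.1.1, p.2), q')) :=
      (hF.comp ((measurable_fst.comp measurable_fst).prodMk measurable_snd)).prodMk
        measurable_const
    have hae : ∀ S : Set ((X × Q) × W), MeasurableSet S →
        MeasurableSet {z : X × Q | ∀ᵐ w ∂d, (z, w) ∈ S} := by
      intro S hS
      have : {z : X × Q | ∀ᵐ w ∂d, (z, w) ∈ S} = {z | d (Prod.mk z ⁻¹' Sᶜ) = 0} := rfl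
      rw [this]
      exact measurable_measure_prodMk_left hS.compl (measurableSet_singleton 0)
    have hint : ∀ U : X × Q → ℝ, Measurable U →
        Measurable (fun z : X × Q => ∫ w, U (F (z.1, w), q') ∂d) := by
      intro U hU
      exact ((hU.comp hg).stronglyMeasurable.integral_prod_right').measurable
    have m1 := hae _ (hg hI)
    have m2 := measurableSet_le (hint _ hVsafe) (hVsafe.sub_const εS)
    have hdiff : Measurable (fun p : (X × Q) × W => Vsafe p.1 - Vsafe (F (p.1.1, p.2), q')) :=
      (hVsafe.comp measurable_fst).sub (hVsafe.comp hg)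
    have m3 := hae _ ((measurableSet_le measurable_const hdiff).inter
      (measurableSet_le hdiff (measurable_const (a := βS + MS))) :
        MeasurableSet ({p | βS ≤ _} ∩ _))
    have m4 : MeasurableSet ({z : X × Q | z.2 ∈ Acc} ∪
        {z | (∫ w, Vlive (F (z.1, w), q') ∂d) ≤ Vlive z - εL}) :=
      (measurable_snd (MeasurableSet.of_discrete (s := Acc))).union
        (measurableSet_le (hint _ hVlive) (hVlive.sub_const εL))
    convert m1.inter (m2.inter (m3.inter m4)) using 1
    ext z
    refine and_congr Iff.rfl (and_congr Iff.rfl (and_congr Iff.rfl ?_))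
    exact imp_iff_not_or.trans (or_congr not_not Iff.rfl)
  obtain ⟨πA, hπ, hπΔ, hsel⟩ := exists_selector Δ hΔ L hL C hC
  have hstep : ∀ x q, (x, q) ∈ I → Vsafe (x, q) < 0 → (x, q) ∈ C (πA (x, q)) := by
    intro x q hxq hv
    apply hsel
    by_cases hq : q ∈ Acc
    · obtain ⟨σ, q', hq', ⟨rfl, h1, h2, h3⟩, _⟩ := hf x q hxq hq hv.le
      exact ⟨q', hq', Filter.Eventually.of_forall h1, h2, Filter.Eventually.of_forall h3,
        fun h => absurd hq h⟩
    · have hr : q ∉ Acc ∪ Qreject Δ Acc := by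
        rintro (h | h)
        · exact hq h
        · exact absurd hv (not_lt.2 (hc x q hxq h))
      obtain ⟨σ, q', hq', ⟨rfl, h1, h2, h3⟩, h4⟩ := he x q hxq hr hv.le
      exact ⟨q', hq', Filter.Eventually.of_forall h1, h2, Filter.Eventually.of_forall h3,
        fun _ => h4⟩
  refine ⟨πA, hπ, hπΔ, fun x₀ hx₀ => ⟨?_, ?_⟩⟩
  · have hbd := safety_bound d dInf hcons F hF πA hπ I Vsafe hVsafe εS MS βS hεS hMS
      (fun x q h hv => (hstep x q h hv).1) (fun x q h hv => (hstep x q h hv).2.1)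
      (fun x q h hv => (hstep x q h hv).2.2.1)
    have hle : dInf {ω | ∀ t, Vsafe (prodTraj F πA x₀ qinit ω t) < 0}ᶜ
        ≤ ENNReal.ofReal (Real.exp (8 * ηS * εS / MS ^ 2)) := by
      have e : {ω | ∀ t, Vsafe (prodTraj F πA x₀ qinit ω t) < 0}ᶜ
          = ⋃ n : ℕ, {ω | ∃ t ≤ n, 0 ≤ Vsafe (prodTraj F πA x₀ qinit ω t)} := by
        ext ω
        simp only [Set.mem_compl_iff, Set.mem_ofPred_eq, Set.mem_iUnion, not_forall, not_lt]
        exact ⟨fun ⟨t, h⟩ => ⟨t, t, le_rfl, h⟩, fun ⟨_, t, _, h⟩ => ⟨t, h⟩⟩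
      rw [e, Monotone.measure_iUnion]
      · refine iSup_le fun n => (hbd n x₀ qinit (ha x₀ hx₀)).trans ?_
        apply ENNReal.ofReal_le_ofReal
        apply Real.exp_le_exp.2
        rw [show 8 * ηS * εS / MS ^ 2 = 8 * εS / MS ^ 2 * ηS by ring]
        exact mul_le_mul_of_nonneg_left (hb x₀ hx₀) (by positivity)
      · rintro m n hmn ω ⟨t, ht, h⟩
        exact ⟨t, ht.trans hmn, h⟩
    have hS : MeasurableSet {ω | ∀ t, Vsafe (prodTraj F πA x₀ qinit ω t) < 0} := by
      have : {ω | ∀ t, Vsafe (prodTraj F πA x₀ qinit ω t) < 0}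
          = ⋂ t, {ω | Vsafe (prodTraj F πA x₀ qinit ω t) < 0} := by
        ext; simp
      rw [this]
      exact MeasurableSet.iInter fun t => measurableSet_lt
        (hVsafe.comp (measurable_prodTraj F hF πA hπ x₀ qinit t)) measurable_const
    rw [ENNReal.ofReal_sub _ (Real.exp_pos _).le, ENNReal.ofReal_one, tsub_le_iff_right]
    rw [← prob_add_prob_compl (μ := dInf) hS]
    exact add_le_add le_rfl hle
  · have hz := live_zero d dInf hcons F hF πA hπ I Vsafe Vlive hVsafe Acc hIntLive εL hεL hd
      (fun x q h hv => (hstep x q h hv).1) (fun x q h hv hq => (hstep x q h hv).2.2.2 hq)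
    rw [← measure_univ (μ := dInf)]
    apply measure_congr
    rw [Filter.eventuallyEq_univ, mem_ae_iff]
    refine measure_mono_null ?_ (measure_iUnion_null fun T => hz T x₀ qinit (ha x₀ hx₀))
    intro ω hω
    simp only [Set.mem_compl_iff, Set.mem_ofPred_eq, not_or, not_exists, not_le,
      Set.not_infinite] at hω
    obtain ⟨hfin, hneg⟩ := hω
    obtain ⟨B, hB⟩ := hfin.bddAbove
    refine Set.mem_iUnion.2 ⟨B + 1, fun t => ⟨hneg t, fun ht hacc => ?_⟩⟩
    have := hB hacc
    omega
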